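/- arXiv:2512.14193 — 2 statements merged into one kernel-verified Lean document; each statement's English description precedes it below -/
import Mathlib

section
/- Let A be the continuous linear operator on X1 × X2 × X3 defined by A(x1, x2, x3) = (x1 + M13 x3, x2 + M23 x3, M31 x1 + M32 x2), and let F : X3 → X3 be the continuous linear map F = −(M31 ∘ M13) − (M32 ∘ M23). Then A is bijective if and only if F is bijective. -/
/-- With `A (x1, x2, x3) = (x1 + M13 x3, x2 + M23 x3, M31 x1 + M32 x2)` and
`F = -(M31 ∘ M13) - (M32 ∘ M23) : X3 → X3`, the operator `A` is bijective if and only if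
`F` is bijective. -/
theorem operator_bijective_iff_schur_bijective
    {X1 X2 X3 : Type*}
    [NormedAddCommGroup X1] [NormedSpace ℂ X1] [CompleteSpace X1]
    [NormedAddCommGroup X2] [NormedSpace ℂ X2] [CompleteSpace X2]
    [NormedAddCommGroup X3] [NormedSpace ℂ X3] [CompleteSpace X3]
    (M13 : X3 →L[ℂ] X1) (M23 : X3 →L[ℂ] X2) (M31 : X1 →L[ℂ] X3) (M32 : X2 →L[ℂ] X3)
    (A : (X1 × X2 × X3) →L[ℂ] (X1 × X2 × X3))
    (hA : ∀ x : X1 × X2 × X3,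
      A x = (x.1 + M13 x.2.2, x.2.1 + M23 x.2.2, M31 x.1 + M32 x.2.1)) :
    Function.Bijective A ↔ Function.Bijective (-(M31.comp M13) - M32.comp M23) := by
  set F : X3 →L[ℂ] X3 := -(M31.comp M13) - M32.comp M23 with hF
  have key : ∀ (a : X1) (b : X2) (z : X3),
      A (a - M13 z, b - M23 z, z) = (a, b, F z + (M31 a + M32 b)) := by
    intro a b z
    rw [hA, hF]
    simp only [map_sub, sub_apply, neg_apply, ContinuousLinearMap.comp_apply, Prod.mk.injEq]
    refine ⟨by abel, by abel, by abel⟩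
  have hdecomp : ∀ x : X1 × X2 × X3,
      x = ((x.1 + M13 x.2.2) - M13 x.2.2, (x.2.1 + M23 x.2.2) - M23 x.2.2, x.2.2) := by
    intro x
    simp
  refine and_congr ⟨fun hinj z w hzw => ?_, fun hinj x y hxy => ?_⟩
    ⟨fun hsurj c => ?_, fun hsurj ⟨a, b, c⟩ => ?_⟩
  · have h := hinj ((key 0 0 z).trans ((by rw [hzw] :
      ((0 : X1), (0 : X2), F z + (M31 0 + M32 0)) = (0, 0, F w + (M31 0 + M32 0))).trans
        (key 0 0 w).symm))
    exact congrArg (fun p => p.2.2) h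
  · rw [hdecomp x, hdecomp y, key, key] at hxy
    simp only [Prod.mk.injEq] at hxy
    obtain ⟨h1, h2, h3⟩ := hxy
    rw [h1, h2] at h3
    have hz := hinj (add_right_cancel h3)
    rw [hdecomp x, hdecomp y, h1, h2, hz]
  · obtain ⟨x, hx⟩ := hsurj (0, 0, c)
    rw [hdecomp x, key] at hx
    simp only [Prod.mk.injEq] at hx
    obtain ⟨h1, h2, h3⟩ := hx
    exact ⟨x.2.2, by simpa [h1, h2] using h3⟩
  · obtain ⟨z, hz⟩ := hsurj (c - (M31 a + M32 b))
    exact ⟨_, (key a b z).trans (by rw [hz, sub_add_cancel])⟩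
end

section
/- Let A be the continuous linear operator on X1 × X2 × X3 defined by A(x1, x2, x3) = (x1 + M13 x3, x2 + M23 x3, M31 x1 + M32 x2), and let F : X3 → X3 be the continuous linear map F = −(M31 ∘ M13) − (M32 ∘ M23). Suppose that F = c • id + K for some nonzero complex number c and some compact continuous linear operator K : X3 → X3, and suppose that A is injective. Then A is surjective. -/
/-- The Fredholm alternative for a compact perturbation of a nonzero scalar operator. -/
theorem IsCompactOperator.surjective_smul_id_add_of_injective
    {𝕜 X : Type*} [NontriviallyNormedField 𝕜]
    [NormedAddCommGroup X] [NormedSpace 𝕜 X] [CompleteSpace X]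
    {K : X →L[𝕜] X} (hK : IsCompactOperator K) {c : 𝕜} (hc : c ≠ 0)
    (hinj : Function.Injective (c • ContinuousLinearMap.id 𝕜 X + K)) :
    Function.Surjective (c • ContinuousLinearMap.id 𝕜 X + K) := by
  rcases hK.hasEigenvalue_or_mem_resolventSet (neg_ne_zero.mpr hc) with h | h
  · obtain ⟨x, hx⟩ := h.exists_hasEigenvector
    have hKx : K x = -c • x := hx.apply_eq_smul
    exact absurd (hinj (a₁ := x) (a₂ := 0) (by simp [hKx])) hx.2
  · rw [spectrum.mem_resolventSet_iff, ContinuousLinearMap.isUnit_iff_bijective] at h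
    intro y
    obtain ⟨x, hx⟩ := h.2 (-y)
    refine ⟨x, ?_⟩
    have hx' : -c • x - K x = -y := by
      simpa [Algebra.algebraMap_eq_smul_one] using hx
    rw [← neg_inj, ← hx']
    simp [sub_eq_add_neg, add_comm]

/-- With `A (x1, x2, x3) = (x1 + M13 x3, x2 + M23 x3, M31 x1 + M32 x2)` and
`F = -(M31 ∘ M13) - (M32 ∘ M23) : X3 → X3`, if `F = c • id + K` with `c ≠ 0` and `K`
a compact operator, and `A` is injective, then `A` is surjective. -/
theorem operator_surjective_of_injective
    {X1 X2 X3 : Type*}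
    [NormedAddCommGroup X1] [NormedSpace ℂ X1] [CompleteSpace X1]
    [NormedAddCommGroup X2] [NormedSpace ℂ X2] [CompleteSpace X2]
    [NormedAddCommGroup X3] [NormedSpace ℂ X3] [CompleteSpace X3]
    (M13 : X3 →L[ℂ] X1) (M23 : X3 →L[ℂ] X2) (M31 : X1 →L[ℂ] X3) (M32 : X2 →L[ℂ] X3)
    (A : (X1 × X2 × X3) →L[ℂ] (X1 × X2 × X3))
    (hA : ∀ x : X1 × X2 × X3,
      A x = (x.1 + M13 x.2.2, x.2.1 + M23 x.2.2, M31 x.1 + M32 x.2.1))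
    (c : ℂ) (hc : c ≠ 0) (K : X3 →L[ℂ] X3) (hK : IsCompactOperator K)
    (hF : -(M31.comp M13) - M32.comp M23 = c • ContinuousLinearMap.id ℂ X3 + K)
    (hinj : Function.Injective A) :
    Function.Surjective A := by
  have hFx (x : X3) : -M31 (M13 x) - M32 (M23 x) =
      (c • ContinuousLinearMap.id ℂ X3 + K) x := by
    simpa using DFunLike.congr_fun hF x
  have hFinj : Function.Injective (c • ContinuousLinearMap.id ℂ X3 + K) := by
    refine (injective_iff_map_eq_zero _).mpr fun x hx => ?_
    have h : A (-M13 x, -M23 x, x) = A 0 := by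
      rw [← hFx, sub_eq_add_neg] at hx
      rw [map_zero, hA]
      simp [hx]
    exact congrArg (fun z => z.2.2) (hinj h)
  rintro ⟨y1, y2, y3⟩
  obtain ⟨x, hx⟩ := hK.surjective_smul_id_add_of_injective hc hFinj (y3 - M31 y1 - M32 y2)
  refine ⟨(y1 - M13 x, y2 - M23 x, x), ?_⟩
  have h : M31 (y1 - M13 x) + M32 (y2 - M23 x) = y3 := by
    rw [← hFx] at hx
    rw [map_sub, map_sub]
    linear_combination (norm := abel) hx
  rw [hA]
  simp only [sub_add_cancel, h]
end
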